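/- arXiv:2401.08731 — 2 statements merged into one kernel-verified Lean document; each statement's English description precedes it below -/
import Mathlib

section
/- For every Schwartz function f : ℝ → ℂ, every x ∈ ℝ, one has the pointwise identity ∫_0^∞ |t·(∂/∂t) P_t f(x)|² dt/t = (1/2) ∫_0^∞ |(φ_t ∗ f)(x)|² dt/t. -/
open MeasureTheory

/-- The subordinated Poisson semigroup of the translation group on `ℝ`:
`P_t f (x) = (1/√π) ∫_0^∞ (e^{−u}/√u) f(x + t²/(4u)) du`. -/
noncomputable def poissonP (f : ℝ → ℂ) (t : ℝ) (x : ℝ) : ℂ :=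
  ((Real.sqrt Real.pi)⁻¹ : ℂ) *
    ∫ u in Set.Ioi (0 : ℝ), ((Real.exp (-u) / Real.sqrt u : ℝ) : ℂ) * f (x + t ^ 2 / (4 * u))
/-- The principal branch value `√(−2πiξ) = √(2π|ξ|)·e^{−i·sgn(ξ)·π/4}`. -/
noncomputable def sqrtSymbol (ξ : ℝ) : ℂ :=
  (Real.sqrt (2 * Real.pi * |ξ|) : ℂ) *
    Complex.exp (-(Real.sign ξ : ℂ) * Complex.I * (Real.pi : ℂ) / 4)

/-- `φ̂(ξ) = −√(−2πiξ)·e^{−√(−2πiξ)}`. -/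
noncomputable def phiHat (ξ : ℝ) : ℂ := -sqrtSymbol ξ * Complex.exp (-sqrtSymbol ξ)

/-- `φ`, the inverse Fourier transform of `φ̂`. -/
noncomputable def phi (x : ℝ) : ℂ :=
  ∫ ξ : ℝ, Complex.exp (2 * (Real.pi : ℂ) * Complex.I * (x : ℂ) * (ξ : ℂ)) * phiHat ξ

/-- The dilation `φ_t(x) = t⁻¹ φ(x/t)`. -/
noncomputable def phiT (t : ℝ) (x : ℝ) : ℂ := ((t : ℂ))⁻¹ * phi (x / t)

open Real Set Filter Topology FourierTransform

/-- The Gaussian tail `∫_z^{∞} e^{-w²} dw` along the horizontal ray issued from `z`. -/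
noncomputable def gaussianTail (z : ℂ) : ℂ :=
  ∫ s in Ioi (0 : ℝ), Complex.exp (-(z + s) ^ 2)

lemma integrable_cexp_neg_add_ofReal_sq (z : ℂ) :
    Integrable fun s : ℝ => Complex.exp (-(z + s) ^ 2) := by
  have h := integrable_cexp_quadratic (b := 1) (by simp) (-2 * z) (-z ^ 2)
  refine h.congr (ae_of_all _ fun s => ?_)
  simp only
  congr 1
  ring

lemma integral_cexp_neg_add_ofReal_sq (z : ℂ) :
    ∫ s : ℝ, Complex.exp (-(z + s) ^ 2) = (√π : ℝ) := by
  have h := integral_cexp_quadratic (b := -1) (by simp) (-2 * z) (-z ^ 2)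
  have h2 : ((√π : ℝ) : ℂ) = ((π : ℂ) / -(-1)) ^ (1 / 2 : ℂ) := by
    rw [Real.sqrt_eq_rpow, Complex.ofReal_cpow pi_pos.le]
    simp
  rw [h2]
  convert h using 1
  · congr 1
    ext s
    congr 1
    ring
  · have : -z ^ 2 - (-2 * z) ^ 2 / (4 * -1) = 0 := by ring
    rw [this, Complex.exp_zero, mul_one]

lemma gaussianTail_neg (z : ℂ) : gaussianTail (-z) = (√π : ℝ) - gaussianTail z := by
  have h := integral_cexp_neg_add_ofReal_sq z
  rw [← integral_add_compl (s := Ioi (0 : ℝ)) measurableSet_Ioi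
    (integrable_cexp_neg_add_ofReal_sq z), compl_Ioi] at h
  rw [← h]
  unfold gaussianTail
  have h2 := integral_comp_neg_Ioi (0 : ℝ) fun s : ℝ => Complex.exp (-(z + s) ^ 2)
  rw [neg_zero] at h2
  rw [add_sub_cancel_left, ← h2]
  congr 1
  ext s
  congr 1
  push_cast
  ring

lemma norm_mul_gaussianTail_le {c z : ℂ} (hz : 0 < z.re)
    (hc : ‖c * Complex.exp (-z ^ 2)‖ ≤ 1) : ‖c * gaussianTail z‖ ≤ 1 / (2 * z.re) := by
  have hint : ∫ s in Ioi (0 : ℝ), Real.exp (-(2 * z.re) * s) = 1 / (2 * z.re) := by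
    rw [integral_exp_mul_Ioi (by linarith)]
    simp
  rw [gaussianTail, ← integral_const_mul, ← hint]
  refine norm_integral_le_of_norm_le (integrableOn_exp_mul_Ioi (by linarith) 0) ?_
  filter_upwards [ae_restrict_mem measurableSet_Ioi] with s hs
  have : c * Complex.exp (-(z + s) ^ 2)
      = c * Complex.exp (-z ^ 2) * Complex.exp (-(2 * z * s) - s ^ 2) := by
    rw [mul_assoc, ← Complex.exp_add]
    congr 2
    ring
  rw [this, norm_mul, Complex.norm_exp]
  refine (mul_le_of_le_one_left (exp_pos _).le hc).trans (exp_le_exp.2 ?_)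
  have : (-(2 * z * (s : ℂ)) - (s : ℂ) ^ 2).re = -(2 * z.re) * s - s ^ 2 := by
    rw [← Complex.ofReal_pow, Complex.sub_re, Complex.ofReal_re]
    simp
  rw [this]
  nlinarith [sq_nonneg s]

lemma norm_cexp_neg_add_ofReal_sq_le {z : ℂ} {R s : ℝ} (hz : ‖z‖ ≤ R) (hs : 0 ≤ s) :
    ‖Complex.exp (-(z + s) ^ 2)‖ ≤ Real.exp (R ^ 2 + 2 * R * s - s ^ 2) := by
  rw [Complex.norm_exp]
  refine exp_le_exp.2 ?_
  have h1 : (-(z + s) ^ 2).re = (-z ^ 2 - 2 * s * z).re - s ^ 2 := by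
    rw [show -(z + (s : ℂ)) ^ 2 = -z ^ 2 - 2 * s * z - ((s ^ 2 : ℝ) : ℂ) by push_cast; ring,
      Complex.sub_re, Complex.ofReal_re]
  have h2 : (-z ^ 2 - 2 * s * z).re ≤ ‖z‖ ^ 2 + 2 * s * ‖z‖ := by
    refine (Complex.re_le_norm _).trans ((norm_sub_le _ _).trans ?_)
    simp [abs_of_nonneg hs]
  have h3 := norm_nonneg z
  rw [h1]
  nlinarith

lemma hasDerivAt_gaussianTail (z : ℂ) :
    HasDerivAt gaussianTail (-Complex.exp (-z ^ 2)) z := by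
  set R := ‖z‖ + 1
  have hd : ∀ w v : ℂ, HasDerivAt (fun y : ℂ => Complex.exp (-(y + v) ^ 2))
      (-(2 * (w + v)) * Complex.exp (-(w + v) ^ 2)) w := by
    intro w v
    refine (((hasDerivAt_id w).add_const v).fun_pow 2).fun_neg.cexp.congr_deriv ?_
    simp only [id]
    push_cast
    ring
  have hgauss : Integrable fun s : ℝ => Real.exp (R ^ 2 + R + (2 * R + 1) * s - s ^ 2) := by
    have h := (integrable_cexp_quadratic (b := 1) (by simp) (2 * R + 1) (R ^ 2 + R)).norm
    refine h.congr (ae_of_all _ fun s => ?_)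
    beta_reduce
    rw [Complex.norm_exp, show -1 * (s : ℂ) ^ 2 + (2 * R + 1) * s + (R ^ 2 + R)
      = ((R ^ 2 + R + (2 * R + 1) * s - s ^ 2 : ℝ) : ℂ) by push_cast; ring, Complex.ofReal_re]
  obtain ⟨h1, h2⟩ := hasDerivAt_integral_of_dominated_loc_of_deriv_le
    (μ := volume.restrict (Ioi (0 : ℝ)))
    (F := fun (w : ℂ) (s : ℝ) => Complex.exp (-(w + s) ^ 2))
    (F' := fun (w : ℂ) (s : ℝ) => -(2 * (w + s)) * Complex.exp (-(w + s) ^ 2))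
    (bound := fun s : ℝ => 2 * Real.exp (R ^ 2 + R + (2 * R + 1) * s - s ^ 2))
    (x₀ := z) (Metric.ball_mem_nhds z one_pos)
    (.of_forall fun w => (integrable_cexp_neg_add_ofReal_sq w).aestronglyMeasurable.restrict)
    (integrable_cexp_neg_add_ofReal_sq z).integrableOn
    (Continuous.aestronglyMeasurable (by fun_prop))
    (by
      filter_upwards [ae_restrict_mem measurableSet_Ioi] with s hs w hw
      have hs : 0 < s := hs
      have hw : ‖w‖ ≤ R := by
        have := norm_sub_norm_le w z
        rw [mem_ball_iff_norm] at hw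
        linarith
      have hws : ‖-(2 * (w + (s : ℂ)))‖ ≤ 2 * Real.exp (R + s) := by
        rw [norm_neg, norm_mul, Complex.norm_two]
        have h1 : ‖w + (s : ℂ)‖ ≤ R + s := by
          refine (norm_add_le _ _).trans ?_
          simp [abs_of_pos hs, hw]
        linarith [add_one_le_exp (R + s)]
      rw [norm_mul]
      refine (mul_le_mul hws (norm_cexp_neg_add_ofReal_sq_le hw hs.le) (norm_nonneg _)
        (by positivity)).trans (le_of_eq ?_)
      rw [mul_assoc, ← Real.exp_add]
      ring_nf)
    (hgauss.integrableOn.const_mul 2)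
    (.of_forall fun s w _ => hd w s)
  have hderiv : ∀ s : ℝ, HasDerivAt (fun s : ℝ => Complex.exp (-(z + s) ^ 2))
      (-(2 * (z + s)) * Complex.exp (-(z + s) ^ 2)) s := by
    intro s
    have := (hd (s : ℂ) z).comp_ofReal
    simpa only [add_comm z] using this
  have hlim : Tendsto (fun s : ℝ => Complex.exp (-(z + s) ^ 2)) atTop (𝓝 0) :=
    tendsto_zero_of_hasDerivAt_of_integrableOn_Ioi (a := 0) (fun s _ => hderiv s) h1
      (integrable_cexp_neg_add_ofReal_sq z).integrableOn
  have h3 := integral_Ioi_of_hasDerivAt_of_tendsto' (a := 0) (fun s _ => hderiv s) h1 hlim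
  rw [h3] at h2
  exact h2.congr_deriv (by simp)

lemma integrableOn_exp_neg_div_sqrt :
    IntegrableOn (fun u : ℝ => Real.exp (-u) / √u) (Ioi 0) := by
  refine (Real.GammaIntegral_convergent (s := 1 / 2) (by norm_num)).congr_fun
    (fun u hu => ?_) measurableSet_Ioi
  have hu : 0 < u := hu
  beta_reduce
  rw [div_eq_mul_inv (Real.exp (-u)), Real.sqrt_eq_rpow, ← Real.rpow_neg hu.le]
  norm_num

lemma norm_cexp_neg_sq_div_le_one {a : ℂ} (ha : 0 ≤ (a ^ 2).re) {u : ℝ} (hu : 0 < u) :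
    ‖Complex.exp (-(a ^ 2 / (4 * u)))‖ ≤ 1 := by
  rw [Complex.norm_exp, Real.exp_le_one_iff,
    show -(a ^ 2 / (4 * (u : ℂ))) = ((-(1 / (4 * u)) : ℝ) : ℂ) * a ^ 2 by push_cast; ring,
    Complex.re_ofReal_mul]
  have : 0 < 1 / (4 * u) := by positivity
  nlinarith

lemma neg_sq_sqrt_add_div (a : ℂ) {u : ℝ} (hu : 0 < u) :
    -((√u : ℝ) + a / (2 * (√u : ℝ))) ^ 2 = -u - a - a ^ 2 / (4 * u) := by
  have h0 : ((√u : ℝ) : ℂ) ≠ 0 := by exact_mod_cast (Real.sqrt_pos.2 hu).ne'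
  have h1 : (u : ℂ) = ((√u : ℝ) : ℂ) ^ 2 := by exact_mod_cast (Real.sq_sqrt hu.le).symm
  rw [h1]
  field_simp
  ring

lemma hasDerivAt_sqrt_add_div (a : ℂ) {u : ℝ} (hu : 0 < u) :
    HasDerivAt (fun u : ℝ => ((√u : ℝ) : ℂ) + a / (2 * (√u : ℝ)))
      (1 / (2 * (√u : ℝ)) - a / (4 * u * (√u : ℝ))) u := by
  have h0 : ((√u : ℝ) : ℂ) ≠ 0 := by exact_mod_cast (Real.sqrt_pos.2 hu).ne'
  have h1 : (u : ℂ) = ((√u : ℝ) : ℂ) ^ 2 := by exact_mod_cast (Real.sq_sqrt hu.le).symm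
  have hs := (Real.hasDerivAt_sqrt hu.ne').ofReal_comp
  have h2 : (2 * ((√u : ℝ) : ℂ)) ≠ 0 := mul_ne_zero two_ne_zero h0
  refine (hs.fun_add ((hasDerivAt_const u a).fun_div (hs.const_mul 2) h2)).congr_deriv ?_
  rw [h1]
  push_cast
  field_simp
  ring

/-- Derivative of one of the two branches of the primitive of the subordination integrand. -/
lemma hasDerivAt_cexp_mul_gaussianTail (a : ℂ) {u : ℝ} (hu : 0 < u) :
    HasDerivAt (fun u : ℝ => Complex.exp a * gaussianTail ((√u : ℝ) + a / (2 * (√u : ℝ))))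
      (-Complex.exp (-u - a ^ 2 / (4 * u)) * (1 / (2 * (√u : ℝ)) - a / (4 * u * (√u : ℝ)))) u := by
  have h := ((hasDerivAt_gaussianTail ((√u : ℝ) + a / (2 * (√u : ℝ)))).comp u
    (hasDerivAt_sqrt_add_div a hu)).const_mul (Complex.exp a)
  refine h.congr_deriv ?_
  rw [neg_sq_sqrt_add_div a hu, ← mul_assoc, mul_neg, ← Complex.exp_add]
  congr 4
  ring

lemma re_sqrt_add_div (a : ℂ) (u : ℝ) :
    (((√u : ℝ) : ℂ) + a / (2 * (√u : ℝ))).re = √u + a.re / (2 * √u) := by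
  rw [Complex.add_re, Complex.ofReal_re, show (2 * ((√u : ℝ) : ℂ)) = ((2 * √u : ℝ) : ℂ) by simp,
    Complex.div_ofReal_re]

lemma norm_cexp_mul_gaussianTail_le {a : ℂ} (ha : 0 ≤ (a ^ 2).re) {u : ℝ} (hu : 0 < u)
    (h : 0 < √u + a.re / (2 * √u)) :
    ‖Complex.exp a * gaussianTail ((√u : ℝ) + a / (2 * (√u : ℝ)))‖
      ≤ 1 / (2 * (√u + a.re / (2 * √u))) := by
  rw [← re_sqrt_add_div a u] at h ⊢
  refine norm_mul_gaussianTail_le h ?_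
  rw [neg_sq_sqrt_add_div a hu, ← Complex.exp_add,
    show a + (-u - a - a ^ 2 / (4 * u)) = ((-u : ℝ) : ℂ) + -(a ^ 2 / (4 * u)) by push_cast; ring,
    Complex.exp_add, norm_mul, Complex.norm_exp, Complex.ofReal_re]
  exact mul_le_one₀ (by simpa using hu.le) (norm_nonneg _) (norm_cexp_neg_sq_div_le_one ha hu)

lemma tendsto_sqrt_add_div_atTop (r : ℝ) :
    Tendsto (fun u : ℝ => √u + r / (2 * √u)) atTop atTop := by
  refine Real.tendsto_sqrt_atTop.atTop_add (C := 0) ?_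
  exact tendsto_const_nhds.div_atTop (Real.tendsto_sqrt_atTop.const_mul_atTop two_pos)

lemma tendsto_sqrt_nhdsGT_zero : Tendsto (fun u : ℝ => √u) (𝓝[>] 0) (𝓝[>] 0) := by
  refine tendsto_nhdsWithin_iff.2 ⟨?_, ?_⟩
  · simpa using (Real.continuous_sqrt.tendsto 0).mono_left nhdsWithin_le_nhds
  · filter_upwards [self_mem_nhdsWithin] with u hu using Real.sqrt_pos.2 hu

lemma tendsto_sqrt_add_div_nhdsGT_zero {r : ℝ} (hr : 0 < r) :
    Tendsto (fun u : ℝ => √u + r / (2 * √u)) (𝓝[>] 0) atTop := by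
  have h := (tendsto_sqrt_nhdsGT_zero.mono_right nhdsWithin_le_nhds)
  have h2 : Tendsto (fun u : ℝ => r / (2 * √u)) (𝓝[>] 0) atTop := by
    have := (tendsto_inv_nhdsGT_zero.comp tendsto_sqrt_nhdsGT_zero).const_mul_atTop (half_pos hr)
    refine this.congr fun u => ?_
    simp only [Function.comp]
    ring
  exact h.add_atTop h2

lemma tendsto_sub_sqrt_nhdsGT_zero {r : ℝ} (hr : 0 < r) :
    Tendsto (fun u : ℝ => r / (2 * √u) - √u) (𝓝[>] 0) atTop := by
  have h := (tendsto_sqrt_nhdsGT_zero.mono_right nhdsWithin_le_nhds)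
  have h3 := (h.const_mul (-2)).add_atTop (tendsto_sqrt_add_div_nhdsGT_zero hr)
  refine h3.congr fun u => ?_
  ring

lemma tendsto_cexp_mul_gaussianTail {a : ℂ} (ha : 0 ≤ (a ^ 2).re) {l : Filter ℝ}
    (hl : ∀ᶠ u in l, 0 < u) (h : Tendsto (fun u : ℝ => √u + a.re / (2 * √u)) l atTop) :
    Tendsto (fun u : ℝ => Complex.exp a * gaussianTail ((√u : ℝ) + a / (2 * (√u : ℝ))))
      l (𝓝 0) := by
  refine squeeze_zero_norm' (a := fun u : ℝ => 1 / (2 * (√u + a.re / (2 * √u)))) ?_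
    (tendsto_const_nhds.div_atTop (h.const_mul_atTop two_pos))
  filter_upwards [hl, h.eventually_gt_atTop 0] with u hu hpos
    using norm_cexp_mul_gaussianTail_le ha hu hpos

lemma tendsto_cexp_neg_mul_gaussianTail_nhdsGT_zero {a : ℂ} (hpos : 0 < a.re)
    (ha : 0 ≤ (a ^ 2).re) :
    Tendsto (fun u : ℝ => Complex.exp (-a) * gaussianTail ((√u : ℝ) + -a / (2 * (√u : ℝ))))
      (𝓝[>] 0) (𝓝 (Complex.exp (-a) * (√π : ℝ))) := by
  suffices Tendsto (fun u : ℝ => Complex.exp (-a) *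
      gaussianTail (-((√u : ℝ) + -a / (2 * (√u : ℝ))))) (𝓝[>] 0) (𝓝 0) by
    have h := this.const_sub (Complex.exp (-a) * (√π : ℝ))
    rw [sub_zero] at h
    refine h.congr fun u => ?_
    rw [gaussianTail_neg]
    ring
  have h := tendsto_sub_sqrt_nhdsGT_zero hpos
  refine squeeze_zero_norm' (a := fun u : ℝ => 1 / (2 * (a.re / (2 * √u) - √u))) ?_
    (tendsto_const_nhds.div_atTop (h.const_mul_atTop two_pos))
  filter_upwards [self_mem_nhdsWithin, h.eventually_gt_atTop 0] with u hu hpos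
  have hu : 0 < u := hu
  have hre : (-(((√u : ℝ) : ℂ) + -a / (2 * (√u : ℝ)))).re = a.re / (2 * √u) - √u := by
    rw [Complex.neg_re, re_sqrt_add_div, Complex.neg_re]
    ring
  rw [← hre] at hpos ⊢
  refine norm_mul_gaussianTail_le hpos ?_
  rw [neg_sq, neg_sq_sqrt_add_div _ hu, ← Complex.exp_add,
    show -a + (-u - -a - (-a) ^ 2 / (4 * u)) = ((-u : ℝ) : ℂ) + -(a ^ 2 / (4 * u)) by
      push_cast; ring,
    Complex.exp_add, norm_mul, Complex.norm_exp, Complex.ofReal_re]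
  exact mul_le_one₀ (by simpa using hu.le) (norm_nonneg _) (norm_cexp_neg_sq_div_le_one ha hu)

lemma integrableOn_exp_neg_div_sqrt_mul_cexp {a : ℂ} (ha : 0 ≤ (a ^ 2).re) :
    IntegrableOn (fun u : ℝ => ((Real.exp (-u) / √u : ℝ) : ℂ) *
      Complex.exp (-(a ^ 2 / (4 * u)))) (Ioi 0) := by
  refine integrableOn_exp_neg_div_sqrt.ofReal.mul_bdd (c := 1) ?_ ?_
  · exact Measurable.aestronglyMeasurable (by fun_prop)
  · filter_upwards [ae_restrict_mem measurableSet_Ioi] with u hu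
      using norm_cexp_neg_sq_div_le_one ha hu

/-- The subordination formula `π^{-1/2} ∫_0^∞ e^{-u} u^{-1/2} e^{-a²/(4u)} du = e^{-a}`, valid up to
the boundary `|arg a| = π/4` of the domain of absolute convergence. -/
lemma integral_exp_neg_div_sqrt_mul_cexp {a : ℂ} (hpos : 0 < a.re) (ha : 0 ≤ (a ^ 2).re) :
    ∫ u in Ioi (0 : ℝ), ((Real.exp (-u) / √u : ℝ) : ℂ) * Complex.exp (-(a ^ 2 / (4 * u)))
      = (√π : ℝ) * Complex.exp (-a) := by
  have ha' : 0 ≤ ((-a) ^ 2).re := by rwa [neg_sq]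
  have hderiv : ∀ u ∈ Ioi (0 : ℝ), HasDerivAt
      (fun u : ℝ => -(Complex.exp a * gaussianTail ((√u : ℝ) + a / (2 * (√u : ℝ))) +
        Complex.exp (-a) * gaussianTail ((√u : ℝ) + -a / (2 * (√u : ℝ)))))
      (((Real.exp (-u) / √u : ℝ) : ℂ) * Complex.exp (-(a ^ 2 / (4 * u)))) u := by
    intro u hu
    refine ((hasDerivAt_cexp_mul_gaussianTail a hu).fun_add
      (hasDerivAt_cexp_mul_gaussianTail (-a) hu)).fun_neg.congr_deriv ?_
    rw [neg_sq, sub_eq_add_neg (-(u : ℂ)), Complex.exp_add]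
    push_cast
    ring
  have hzero := ((tendsto_cexp_mul_gaussianTail ha self_mem_nhdsWithin
    (tendsto_sqrt_add_div_nhdsGT_zero hpos)).add
    (tendsto_cexp_neg_mul_gaussianTail_nhdsGT_zero hpos ha)).neg
  have htop := ((tendsto_cexp_mul_gaussianTail ha (eventually_gt_atTop 0)
    (tendsto_sqrt_add_div_atTop _)).add
    (tendsto_cexp_mul_gaussianTail ha' (eventually_gt_atTop 0) (tendsto_sqrt_add_div_atTop _))).neg
  have h := integral_Ioi_deriv_mul_eq_sub (a := (0 : ℝ)) (u := fun _ => (1 : ℂ))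
    (u' := fun _ => 0) (fun u _ => hasDerivAt_const u 1) hderiv ?_
    (hzero.congr fun u => by simp) (htop.congr fun u => by simp)
  · simp only [zero_mul, one_mul, zero_add] at h
    rw [h]
    simp
    ring
  · refine (integrableOn_exp_neg_div_sqrt_mul_cexp ha).congr_fun (fun u _ => ?_) measurableSet_Ioi
    simp

lemma sqrtSymbol_eq (ξ : ℝ) : sqrtSymbol ξ =
    (√(2 * π * |ξ|) : ℝ) * Complex.exp ((-(Real.sign ξ * (π / 4)) : ℝ) * Complex.I) := by
  rw [sqrtSymbol]
  congr 2
  push_cast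
  ring

lemma norm_sqrtSymbol (ξ : ℝ) : ‖sqrtSymbol ξ‖ = √(2 * π * |ξ|) := by
  rw [sqrtSymbol_eq, norm_mul, Complex.norm_exp_ofReal_mul_I, mul_one, Complex.norm_real,
    Real.norm_of_nonneg (Real.sqrt_nonneg _)]

lemma sqrtSymbol_re (ξ : ℝ) : (sqrtSymbol ξ).re = √(π * |ξ|) := by
  rw [sqrtSymbol_eq, Complex.re_ofReal_mul, Complex.exp_ofReal_mul_I_re]
  rcases eq_or_ne ξ 0 with rfl | hξ
  · simp
  have hcos : Real.cos (-(Real.sign ξ * (π / 4))) = √2 / 2 := by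
    rw [Real.cos_neg, ← Real.cos_pi_div_four]
    rcases Real.sign_apply_eq_of_ne_zero ξ hξ with h | h <;> simp [h]
  rw [hcos, mul_assoc, Real.sqrt_mul zero_le_two]
  linear_combination (√(π * |ξ|) / 2) * Real.mul_self_sqrt zero_le_two

lemma sqrtSymbol_sq (ξ : ℝ) : sqrtSymbol ξ ^ 2 = -2 * π * Complex.I * ξ := by
  have hs : ((√(2 * π * |ξ|) : ℝ) : ℂ) ^ 2 = 2 * π * (|ξ| : ℝ) := by
    exact_mod_cast Real.sq_sqrt (by positivity)
  rw [sqrtSymbol_eq, mul_pow, hs, ← Complex.exp_nat_mul]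
  rcases lt_trichotomy ξ 0 with h | rfl | h
  · rw [Real.sign_of_neg h, abs_of_neg h,
      show ((2 : ℕ) : ℂ) * (((-(-1 * (π / 4)) : ℝ) : ℂ) * Complex.I) = π / 2 * Complex.I by
        push_cast; ring, Complex.exp_pi_div_two_mul_I]
    push_cast
    ring
  · simp
  · rw [Real.sign_of_pos h, abs_of_pos h,
      show ((2 : ℕ) : ℂ) * (((-(1 * (π / 4)) : ℝ) : ℂ) * Complex.I) = -π / 2 * Complex.I by
        push_cast; ring, Complex.exp_neg_pi_div_two_mul_I]
    ring

lemma sqrtSymbol_sq_mul {t : ℝ} (ht : 0 < t) (ξ : ℝ) :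
    sqrtSymbol (t ^ 2 * ξ) = t * sqrtSymbol ξ := by
  have hsign : Real.sign (t ^ 2 * ξ) = Real.sign ξ := by
    have ht2 : 0 < t ^ 2 := by positivity
    rcases lt_trichotomy ξ 0 with h | rfl | h
    · rw [Real.sign_of_neg h, Real.sign_of_neg (mul_neg_of_pos_of_neg ht2 h)]
    · simp
    · rw [Real.sign_of_pos h, Real.sign_of_pos (mul_pos ht2 h)]
  have hsqrt : √(2 * π * |t ^ 2 * ξ|) = t * √(2 * π * |ξ|) := by
    rw [abs_mul, abs_of_nonneg (sq_nonneg t), mul_left_comm, Real.sqrt_mul (sq_nonneg t),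
      Real.sqrt_sq ht.le]
  rw [sqrtSymbol, sqrtSymbol, hsign, hsqrt]
  push_cast
  ring

@[fun_prop]
lemma measurable_sqrtSymbol : Measurable sqrtSymbol := by
  have h : Measurable Real.sign := by
    unfold Real.sign
    exact Measurable.ite measurableSet_Iio measurable_const
      (Measurable.ite measurableSet_Ioi measurable_const measurable_const)
  unfold sqrtSymbol
  fun_prop

@[fun_prop]
lemma measurable_phiHat : Measurable phiHat := by
  unfold phiHat
  fun_prop

lemma integrable_phiHat : Integrable phiHat := by
  have h1 := integrableOn_rpow_mul_exp_neg_mul_rpow (p := 1 / 2) (s := 1 / 2) (b := √π)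
    (by norm_num) (by norm_num) (by positivity)
  have h2 : Integrable fun ξ : ℝ => ‖ξ‖ ^ (1 / 2 : ℝ) * Real.exp (-√π * ‖ξ‖ ^ (1 / 2 : ℝ)) :=
    (integrable_fun_norm_addHaar volume
      (f := fun r : ℝ => r ^ (1 / 2 : ℝ) * Real.exp (-√π * r ^ (1 / 2 : ℝ)))).2 (by simpa using h1)
  refine (h2.const_mul √(2 * π)).mono' measurable_phiHat.aestronglyMeasurable
    (ae_of_all _ fun ξ => le_of_eq ?_)
  rw [phiHat, norm_mul, norm_neg, norm_sqrtSymbol, Complex.norm_exp, Complex.neg_re, sqrtSymbol_re,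
    Real.sqrt_mul (by positivity), Real.sqrt_mul (x := π) (by positivity), ← Real.sqrt_eq_rpow,
    Real.norm_eq_abs]
  ring_nf

lemma phiT_eq_integral {s : ℝ} (hs : 0 < s) (z : ℝ) :
    phiT s z = ∫ ξ : ℝ, Complex.exp (2 * π * Complex.I * z * ξ) * phiHat (s * ξ) := by
  have h := Measure.integral_comp_mul_left
    (fun ξ : ℝ => Complex.exp (2 * π * Complex.I * ((z / s : ℝ) : ℂ) * ξ) * phiHat ξ) s
  rw [phiT, phi, ← Complex.ofReal_inv, ← Complex.real_smul, ← abs_of_pos (inv_pos.2 hs), ← h]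
  congr 1
  ext ξ
  have : (s : ℂ) ≠ 0 := by exact_mod_cast hs.ne'
  congr 2
  push_cast
  field_simp

lemma norm_cexp_two_pi_mul_I (x ξ : ℝ) : ‖Complex.exp (2 * π * Complex.I * x * ξ)‖ = 1 := by
  rw [show 2 * π * Complex.I * x * ξ = ((2 * π * x * ξ : ℝ) : ℂ) * Complex.I by push_cast; ring,
    Complex.norm_exp_ofReal_mul_I]

lemma norm_cexp_neg_mul_sqrtSymbol_le_one {t : ℝ} (ht : 0 ≤ t) (ξ : ℝ) :
    ‖Complex.exp (-(t * sqrtSymbol ξ))‖ ≤ 1 := by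
  rw [Complex.norm_exp, Real.exp_le_one_iff, Complex.neg_re, Complex.re_ofReal_mul, sqrtSymbol_re]
  exact neg_nonpos.2 (by positivity)

lemma SchwartzMap.integral_cexp_mul_fourier (f : SchwartzMap ℝ ℂ) (x : ℝ) :
    ∫ ξ : ℝ, Complex.exp (2 * π * Complex.I * x * ξ) * 𝓕 f ξ = f x := by
  have h : 𝓕⁻ (𝓕 f) x = f x := by simp
  rw [SchwartzMap.fourierInv_coe, Real.fourierInv_eq'] at h
  rw [← h]
  congr 1
  ext ξ
  rw [smul_eq_mul]
  congr 2
  simp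
  ring

lemma integral_phiT_mul_eq (f : SchwartzMap ℝ ℂ) {s : ℝ} (hs : 0 < s) (x : ℝ) :
    ∫ y : ℝ, phiT s (x - y) * f y
      = ∫ ξ : ℝ, phiHat (s * ξ) * (Complex.exp (2 * π * Complex.I * x * ξ) * 𝓕 f ξ) := by
  have hswap : Integrable (Function.uncurry fun (y ξ : ℝ) =>
      Complex.exp (2 * π * Complex.I * (x - y : ℝ) * ξ) * phiHat (s * ξ) * f y)
      (volume.prod volume) := by
    have h := (f.integrable (μ := volume)).mul_prod (integrable_phiHat.comp_mul_left' hs.ne')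
    refine h.mono (Measurable.aestronglyMeasurable ?_) (ae_of_all _ fun p => ?_)
    · have := f.continuous.measurable
      unfold Function.uncurry
      fun_prop
    · rw [Function.uncurry, norm_mul, norm_mul, norm_cexp_two_pi_mul_I, norm_mul, one_mul, mul_comm]
  simp_rw [phiT_eq_integral hs, ← integral_mul_const]
  rw [integral_integral_swap hswap]
  congr 1
  ext ξ
  rw [SchwartzMap.fourier_coe, Real.fourier_real_eq_integral_exp_smul, ← mul_assoc,
    ← integral_const_mul]
  congr 1
  ext y
  rw [smul_eq_mul, ← mul_assoc, mul_assoc (phiHat _), ← Complex.exp_add, mul_comm (phiHat _)]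
  congr 3
  push_cast
  ring

lemma integrable_cexp_mul_fourier (f : SchwartzMap ℝ ℂ) (x : ℝ) :
    Integrable fun ξ : ℝ => Complex.exp (2 * π * Complex.I * x * ξ) * 𝓕 f ξ :=
  (𝓕 f).integrable.bdd_mul (c := 1) (Continuous.aestronglyMeasurable (by fun_prop))
    (ae_of_all _ fun ξ => (norm_cexp_two_pi_mul_I x ξ).le)

lemma poissonP_eq_integral (f : SchwartzMap ℝ ℂ) {t : ℝ} (ht : 0 < t) (x : ℝ) :
    poissonP f t x = ∫ ξ : ℝ, Complex.exp (-(t * sqrtSymbol ξ)) *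
      (Complex.exp (2 * π * Complex.I * x * ξ) * 𝓕 f ξ) := by
  have hsq : ∀ ξ : ℝ, (t * sqrtSymbol ξ) ^ 2 = ((t ^ 2 * (-2 * π * ξ) : ℝ) : ℂ) * Complex.I := by
    intro ξ
    rw [mul_pow, sqrtSymbol_sq]
    push_cast
    ring
  have hre : ∀ ξ : ℝ, 0 ≤ ((t * sqrtSymbol ξ) ^ 2).re := by
    intro ξ
    rw [hsq, Complex.re_ofReal_mul, Complex.I_re, mul_zero]
  have hswap : Integrable (Function.uncurry fun (u ξ : ℝ) =>
      ((Real.exp (-u) / √u : ℝ) : ℂ) * Complex.exp (-((t * sqrtSymbol ξ) ^ 2 / (4 * u))) *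
        (Complex.exp (2 * π * Complex.I * x * ξ) * 𝓕 f ξ))
      ((volume.restrict (Ioi 0)).prod volume) := by
    have h := integrableOn_exp_neg_div_sqrt.ofReal (𝕜 := ℂ) |>.mul_prod
      (integrable_cexp_mul_fourier f x)
    refine h.mono (Measurable.aestronglyMeasurable ?_) ?_
    · have := (𝓕 f).continuous.measurable
      unfold Function.uncurry
      fun_prop
    · have hmem : ∀ᵐ p : ℝ × ℝ ∂((volume.restrict (Ioi 0)).prod volume), p.1 ∈ Ioi (0 : ℝ) :=
        Measure.quasiMeasurePreserving_fst.ae (ae_restrict_mem measurableSet_Ioi)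
      filter_upwards [hmem] with p hp
      rw [Function.uncurry, norm_mul, norm_mul]
      exact (mul_le_mul_of_nonneg_right (mul_le_of_le_one_right (norm_nonneg _)
        (norm_cexp_neg_sq_div_le_one (hre p.2) hp)) (norm_nonneg _)).trans_eq (norm_mul _ _).symm
  have hπ : ((√π : ℝ) : ℂ) ≠ 0 := by exact_mod_cast (Real.sqrt_pos.2 pi_pos).ne'
  have hinner : ∀ u ∈ Ioi (0 : ℝ), ((Real.exp (-u) / √u : ℝ) : ℂ) * f (x + t ^ 2 / (4 * u))
      = ∫ ξ : ℝ, ((Real.exp (-u) / √u : ℝ) : ℂ) *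
        Complex.exp (-((t * sqrtSymbol ξ) ^ 2 / (4 * u))) *
        (Complex.exp (2 * π * Complex.I * x * ξ) * 𝓕 f ξ) := by
    intro u _
    rw [← f.integral_cexp_mul_fourier, ← integral_const_mul]
    congr 1
    ext ξ
    rw [hsq, mul_assoc ((Real.exp (-u) / √u : ℝ) : ℂ), ← mul_assoc (Complex.exp (-_)),
      ← Complex.exp_add]
    congr 3
    push_cast
    ring
  rw [poissonP, setIntegral_congr_fun measurableSet_Ioi hinner, integral_integral_swap hswap,
    ← integral_const_mul]
  refine integral_congr_ae ?_
  filter_upwards [Measure.ae_ne volume (0 : ℝ)] with ξ hξ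
  have hpos : 0 < ((t : ℂ) * sqrtSymbol ξ).re := by
    rw [Complex.re_ofReal_mul, sqrtSymbol_re]
    positivity
  rw [integral_mul_const, integral_exp_neg_div_sqrt_mul_cexp hpos (hre ξ), ← mul_assoc,
    ← mul_assoc _⁻¹, inv_mul_cancel₀ hπ, one_mul]

lemma hasDerivAt_integral_cexp_neg_mul_sqrtSymbol (f : SchwartzMap ℝ ℂ) {t : ℝ} (ht : 0 < t)
    (x : ℝ) :
    HasDerivAt (fun s : ℝ => ∫ ξ : ℝ, Complex.exp (-(s * sqrtSymbol ξ)) *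
        (Complex.exp (2 * π * Complex.I * x * ξ) * 𝓕 f ξ))
      (∫ ξ : ℝ, -sqrtSymbol ξ * Complex.exp (-(t * sqrtSymbol ξ)) *
        (Complex.exp (2 * π * Complex.I * x * ξ) * 𝓕 f ξ)) t := by
  have hf := (𝓕 f).continuous.measurable
  have hbound : Integrable fun ξ : ℝ => ‖𝓕 f ξ‖ + 2 * π * (‖ξ‖ ^ 1 * ‖𝓕 f ξ‖) :=
    (𝓕 f).integrable.norm.add (((𝓕 f).integrable_pow_mul volume 1).const_mul _)
  refine (hasDerivAt_integral_of_dominated_loc_of_deriv_le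
    (F := fun (s ξ : ℝ) => Complex.exp (-(s * sqrtSymbol ξ)) *
      (Complex.exp (2 * π * Complex.I * x * ξ) * 𝓕 f ξ))
    (F' := fun (s ξ : ℝ) => -sqrtSymbol ξ * Complex.exp (-(s * sqrtSymbol ξ)) *
      (Complex.exp (2 * π * Complex.I * x * ξ) * 𝓕 f ξ)) (Ioi_mem_nhds ht)
    (.of_forall fun s => Measurable.aestronglyMeasurable (by fun_prop)) ?_
    (Measurable.aestronglyMeasurable (by fun_prop)) (ae_of_all _ fun ξ s hs => ?_) hbound
    (ae_of_all _ fun ξ s _ => ?_)).2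
  · exact (integrable_cexp_mul_fourier f x).bdd_mul (c := 1)
      (Measurable.aestronglyMeasurable (by fun_prop))
      (ae_of_all _ (norm_cexp_neg_mul_sqrtSymbol_le_one ht.le))
  · have hsqrt : √(2 * π * |ξ|) ≤ 1 + 2 * π * |ξ| := by
      have h0 : 0 ≤ 2 * π * |ξ| := by positivity
      refine Real.sqrt_le_iff.2 ⟨by positivity, ?_⟩
      nlinarith
    rw [norm_mul, norm_mul, norm_neg, norm_sqrtSymbol, norm_mul, norm_cexp_two_pi_mul_I, one_mul,
      pow_one, Real.norm_eq_abs]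
    have h1 : √(2 * π * |ξ|) * ‖Complex.exp (-(s * sqrtSymbol ξ))‖ ≤ 1 + 2 * π * |ξ| :=
      (mul_le_of_le_one_right (Real.sqrt_nonneg _)
        (norm_cexp_neg_mul_sqrtSymbol_le_one (le_of_lt hs) ξ)).trans hsqrt
    calc _ ≤ (1 + 2 * π * |ξ|) * ‖𝓕 f ξ‖ := mul_le_mul_of_nonneg_right h1 (norm_nonneg _)
      _ = _ := by ring
  · refine (((hasDerivAt_id s).ofReal_comp.mul_const (sqrtSymbol ξ)).fun_neg.cexp.mul_const
      _).congr_deriv ?_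
    simp only [id, Complex.ofReal_one]
    ring

/-- `t ∂_t P_t f = φ_{t²} ∗ f`. -/
lemma mul_deriv_poissonP (f : SchwartzMap ℝ ℂ) {t : ℝ} (ht : 0 < t) (x : ℝ) :
    (t : ℂ) * deriv (fun s => poissonP f s x) t = ∫ y : ℝ, phiT (t ^ 2) (x - y) * f y := by
  have h : (fun s => poissonP f s x) =ᶠ[𝓝 t] fun s : ℝ =>
      ∫ ξ : ℝ, Complex.exp (-(s * sqrtSymbol ξ)) *
        (Complex.exp (2 * π * Complex.I * x * ξ) * 𝓕 f ξ) := by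
    filter_upwards [Ioi_mem_nhds ht] with s hs using poissonP_eq_integral f hs x
  rw [h.deriv_eq, (hasDerivAt_integral_cexp_neg_mul_sqrtSymbol f ht x).deriv,
    integral_phiT_mul_eq f (by positivity), ← integral_const_mul]
  congr 1
  ext ξ
  rw [phiHat, sqrtSymbol_sq_mul ht]
  ring

/-- For every Schwartz function `f` and every `x ∈ ℝ`,
`∫_0^∞ |t·∂_t P_t f(x)|² dt/t = (1/2) ∫_0^∞ |(φ_t ∗ f)(x)|² dt/t`. -/
theorem poisson_square_eq_half_conv_square (f : SchwartzMap ℝ ℂ) (x : ℝ) :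
    ∫ t in Set.Ioi (0 : ℝ), ‖(t : ℂ) * deriv (fun s => poissonP (⇑f) s x) t‖ ^ 2 / t
      = (1 / 2) * ∫ t in Set.Ioi (0 : ℝ), ‖∫ y : ℝ, phiT t (x - y) * f y‖ ^ 2 / t := by
  rw [← integral_comp_rpow_Ioi_of_pos (p := 2) two_pos
      (g := fun t : ℝ => ‖∫ y : ℝ, phiT t (x - y) * f y‖ ^ 2 / t), ← integral_const_mul]
  refine setIntegral_congr_fun measurableSet_Ioi fun t ht => ?_
  have ht : 0 < t := ht
  have ht1 : t ^ ((2 : ℝ) - 1) = t := by norm_num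
  simp only [mul_deriv_poissonP f ht x, smul_eq_mul, Real.rpow_two, ht1]
  field_simp
end

section
/- Let h : (0,∞) → ℂ be bounded and continuous, let m(s) = (1/s)∫_0^s h(r) dr be its averages, and define Q(t) = (1/(2√π)) ∫_0^∞ (t/s^{3/2}) e^{−t²/(4s)} h(s) ds for t > 0. Then Q is differentiable on (0,∞) and for every t > 0: t·Q'(t) = (1/(2√π)) ∫_0^∞ (t·s^{−3/2} − (t³/2)·s^{−5/2}) e^{−t²/(4s)} h(s) ds = ∫_0^∞ ψ(t/√s) · m(s) · ds/s = ∫_0^∞ ψ(1/√s) · m(t²s) · ds/s. -/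
open MeasureTheory

/-- `ψ(r) = (1/(16√π)) (12r − 12r³ + r⁵) e^{−r²/4}`. -/
noncomputable def psi (r : ℝ) : ℝ :=
  (16 * Real.sqrt Real.pi)⁻¹ * (12 * r - 12 * r ^ 3 + r ^ 5) * Real.exp (-(r ^ 2) / 4)

/-- The averages `m(s) = (1/s)∫_0^s h(r) dr`. -/
noncomputable def ergAvg (h : ℝ → ℂ) (s : ℝ) : ℂ := ((s : ℂ))⁻¹ * ∫ r in (0 : ℝ)..s, h r

/-- `Q(t) = (1/(2√π)) ∫_0^∞ (t/s^{3/2}) e^{−t²/(4s)} h(s) ds`. -/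
noncomputable def subordQ (h : ℝ → ℂ) (t : ℝ) : ℂ :=
  ((2 * Real.sqrt Real.pi)⁻¹ : ℂ) *
    ∫ s in Set.Ioi (0 : ℝ), ((t / s ^ ((3 : ℝ) / 2) * Real.exp (-t ^ 2 / (4 * s)) : ℝ) : ℂ) * h s

/-- The kernel `s ↦ s^{-p} e^{-a/s}`. -/
noncomputable def invGammaKernel (p a s : ℝ) : ℝ := s ^ (-p) * Real.exp (-a / s)

lemma invGammaKernel_nonneg (p a : ℝ) {s : ℝ} (hs : 0 < s) : 0 ≤ invGammaKernel p a s :=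
  mul_nonneg (Real.rpow_nonneg hs.le _) (Real.exp_pos _).le

lemma invGammaKernel_anti (p : ℝ) {a b s : ℝ} (hab : a ≤ b) (hs : 0 < s) :
    invGammaKernel p b s ≤ invGammaKernel p a s := by
  unfold invGammaKernel
  gcongr

lemma mul_invGammaKernel (p a : ℝ) {s : ℝ} (hs : 0 < s) :
    s * invGammaKernel (p + 1) a s = invGammaKernel p a s := by
  have : s ^ (-p) = s * s ^ (-(p + 1)) := by
    rw [show -p = 1 + -(p + 1) by ring, Real.rpow_add hs, Real.rpow_one]
  simp only [invGammaKernel, this, mul_assoc]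

lemma hasDerivAt_invGammaKernel (p a : ℝ) {s : ℝ} (hs : 0 < s) :
    HasDerivAt (invGammaKernel p a)
      (-p * invGammaKernel (p + 1) a s + a * invGammaKernel (p + 2) a s) s := by
  have h1 := Real.hasDerivAt_rpow_const (x := s) (p := -p) (Or.inl hs.ne')
  have h2 := ((hasDerivAt_const s (-a)).div (hasDerivAt_id s) hs.ne').exp
  refine (h1.mul h2).congr_deriv ?_
  have e1 : s ^ (-p - 1) = s ^ (-(p + 1)) := by congr 1; ring
  have e2 : s ^ (-p) = s ^ (-(p + 2)) * s ^ 2 := by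
    rw [← Real.rpow_natCast, ← Real.rpow_add hs]; congr 1; push_cast; ring
  simp only [invGammaKernel, e1, e2, id, Pi.div_apply]
  field_simp
  ring

lemma continuousOn_invGammaKernel (p a : ℝ) :
    ContinuousOn (invGammaKernel p a) (Set.Ioi 0) := fun _ hs =>
  (hasDerivAt_invGammaKernel p a hs).continuousAt.continuousWithinAt

lemma integrableOn_invGammaKernel {p a : ℝ} (hp : 1 < p) (ha : 0 < a) :
    IntegrableOn (invGammaKernel p a) (Set.Ioi 0) := by
  have h1 : IntegrableOn (fun x : ℝ => x ^ (p - 2) * Real.exp (-a * x ^ (1 : ℝ))) (Set.Ioi 0) :=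
    integrableOn_rpow_mul_exp_neg_mul_rpow (by linarith) (by norm_num) ha
  rw [← integrableOn_Ioi_comp_rpow_iff _ (show (-1 : ℝ) ≠ 0 by norm_num)] at h1
  refine h1.congr_fun (fun s hs => ?_) measurableSet_Ioi
  have hs : 0 < s := hs
  have e : s ^ (-p) = s ^ (-2 : ℝ) * s ^ (-(p - 2)) := by
    rw [← Real.rpow_add hs]; congr 1; ring
  simp only [invGammaKernel, e, smul_eq_mul, ← Real.rpow_mul hs.le]
  norm_num
  rw [Real.rpow_neg_one, div_eq_mul_inv, neg_mul, mul_assoc]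

lemma tendsto_invGammaKernel_zero (p : ℝ) {a : ℝ} (ha : 0 < a) :
    Filter.Tendsto (invGammaKernel p a) (nhdsWithin 0 (Set.Ioi 0)) (nhds 0) := by
  refine ((tendsto_rpow_mul_exp_neg_mul_atTop_nhds_zero p a ha).comp
    tendsto_inv_nhdsGT_zero).congr' ?_
  filter_upwards [self_mem_nhdsWithin] with s hs
  have hs : 0 < s := hs
  simp [invGammaKernel, Real.inv_rpow hs.le, Real.rpow_neg hs.le, div_eq_mul_inv]

lemma tendsto_invGammaKernel_atTop {p : ℝ} (a : ℝ) (hp : 0 < p) :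
    Filter.Tendsto (invGammaKernel p a) Filter.atTop (nhds 0) := by
  have h := (tendsto_rpow_neg_atTop hp).mul
    (Real.continuous_exp.continuousAt.tendsto.comp
      ((tendsto_const_nhds (x := -a)).div_atTop Filter.tendsto_id))
  rw [zero_mul] at h
  exact h

lemma integrableOn_ofReal_mul_of_bdd {k : ℝ → ℝ} {S : Set ℝ} (hk : IntegrableOn k S)
    {h : ℝ → ℂ} (hcont : Continuous h) {M : ℝ} (hM : ∀ s, ‖h s‖ ≤ M) :
    IntegrableOn (fun s => (k s : ℂ) * h s) S :=
  hk.ofReal.mul_bdd (c := M) hcont.aestronglyMeasurable (.of_forall hM)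

lemma subordQ_eq (h : ℝ → ℂ) (t : ℝ) :
    subordQ h t = ((2 * Real.sqrt Real.pi)⁻¹ : ℂ) *
      ∫ s in Set.Ioi (0 : ℝ), ((t * invGammaKernel (3 / 2) (t ^ 2 / 4) s : ℝ) : ℂ) * h s := by
  unfold subordQ
  congr 1
  refine setIntegral_congr_fun measurableSet_Ioi fun s hs => ?_
  have hs : 0 < s := hs
  simp only [invGammaKernel, Real.rpow_neg hs.le]
  rw [show -t ^ 2 / (4 * s) = -(t ^ 2 / 4) / s by field_simp]
  congr 2
  ring

/-- The `s`-kernel of `t Q'(t)`, up to the factor `1/(2√π)`. -/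
noncomputable def subordKernel (t s : ℝ) : ℝ :=
  t * invGammaKernel (3 / 2) (t ^ 2 / 4) s - t ^ 3 / 2 * invGammaKernel (5 / 2) (t ^ 2 / 4) s

lemma subordKernel_eq (t : ℝ) (s : ℝ) :
    subordKernel t s = (t * s ^ (-(3 : ℝ) / 2) - t ^ 3 / 2 * s ^ (-(5 : ℝ) / 2)) *
      Real.exp (-t ^ 2 / (4 * s)) := by
  rw [subordKernel, show -t ^ 2 / (4 * s) = -(t ^ 2 / 4) / s by ring]
  simp only [invGammaKernel, neg_div]
  ring

lemma integrableOn_subordKernel {t : ℝ} (ht : 0 < t) :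
    IntegrableOn (subordKernel t) (Set.Ioi 0) :=
  ((integrableOn_invGammaKernel (by norm_num) (by positivity)).const_mul _).sub
    ((integrableOn_invGammaKernel (by norm_num) (by positivity)).const_mul _)

lemma hasDerivAt_mul_invGammaKernel (t s : ℝ) (hs : 0 < s) :
    HasDerivAt (fun x => x * invGammaKernel (3 / 2) (x ^ 2 / 4) s)
      (invGammaKernel (3 / 2) (t ^ 2 / 4) s -
        t ^ 2 / 2 * invGammaKernel (5 / 2) (t ^ 2 / 4) s) t := by
  have h1 : HasDerivAt (fun x : ℝ => -(x ^ 2 / 4) / s) (-(2 * t / 4) / s) t := by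
    simpa using (((hasDerivAt_pow 2 t).div_const 4).neg).div_const s
  refine ((hasDerivAt_id t).mul (h1.exp.const_mul (s ^ (-(3 / 2) : ℝ)))).congr_deriv ?_
  have e : s ^ (-(3 / 2) : ℝ) = s ^ (-(5 / 2) : ℝ) * s := by
    rw [← Real.rpow_add_one hs.ne']; norm_num
  simp only [invGammaKernel, e, id]
  field_simp
  ring

lemma hasDerivAt_subordQ {h : ℝ → ℂ} (hcont : Continuous h) {M : ℝ} (hM : ∀ s, ‖h s‖ ≤ M)
    {t : ℝ} (ht : 0 < t) :
    HasDerivAt (subordQ h) (((2 * Real.sqrt Real.pi)⁻¹ : ℂ) * ∫ s in Set.Ioi (0 : ℝ),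
      ((invGammaKernel (3 / 2) (t ^ 2 / 4) s -
        t ^ 2 / 2 * invGammaKernel (5 / 2) (t ^ 2 / 4) s : ℝ) : ℂ) * h s) t := by
  rw [show subordQ h = _ from funext (subordQ_eq h)]
  refine HasDerivAt.const_mul _ ?_
  have hint (x : ℝ) (hx : 0 < x) : IntegrableOn
      (fun s => ((x * invGammaKernel (3 / 2) (x ^ 2 / 4) s : ℝ) : ℂ) * h s) (Set.Ioi 0) :=
    integrableOn_ofReal_mul_of_bdd
      ((integrableOn_invGammaKernel (by norm_num) (by positivity)).const_mul x) hcont hM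
  have hint' : IntegrableOn (fun s => ((invGammaKernel (3 / 2) (t ^ 2 / 4) s -
        t ^ 2 / 2 * invGammaKernel (5 / 2) (t ^ 2 / 4) s : ℝ) : ℂ) * h s) (Set.Ioi 0) :=
    integrableOn_ofReal_mul_of_bdd
      ((integrableOn_invGammaKernel (by norm_num) (by positivity)).sub
        ((integrableOn_invGammaKernel (by norm_num) (by positivity)).const_mul _)) hcont hM
  refine (hasDerivAt_integral_of_dominated_loc_of_deriv_le (μ := volume.restrict (Set.Ioi 0))
    (F := fun x s => ((x * invGammaKernel (3 / 2) (x ^ 2 / 4) s : ℝ) : ℂ) * h s)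
    (F' := fun x s => ((invGammaKernel (3 / 2) (x ^ 2 / 4) s -
        x ^ 2 / 2 * invGammaKernel (5 / 2) (x ^ 2 / 4) s : ℝ) : ℂ) * h s)
    (bound := fun s => (invGammaKernel (3 / 2) ((t / 2) ^ 2 / 4) s +
        (2 * t) ^ 2 / 2 * invGammaKernel (5 / 2) ((t / 2) ^ 2 / 4) s) * M)
    (Ioo_mem_nhds (show t / 2 < t by linarith) (show t < 2 * t by linarith))
    ?_ (hint t ht) hint'.aestronglyMeasurable ?_ ?_ ?_).2
  · filter_upwards [lt_mem_nhds ht] with x hx using (hint x hx).aestronglyMeasurable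
  · filter_upwards [ae_restrict_mem measurableSet_Ioi] with s hs x hx
    have hs : 0 < s := hs
    obtain ⟨hx1, hx2⟩ := hx
    have hx0 : 0 < x := by linarith
    have hle : (t / 2) ^ 2 / 4 ≤ x ^ 2 / 4 := by gcongr
    rw [norm_mul, Complex.norm_real]
    refine mul_le_mul ((norm_sub_le _ _).trans ?_) (hM s) (norm_nonneg _)
      (add_nonneg (invGammaKernel_nonneg _ _ hs)
        (mul_nonneg (by positivity) (invGammaKernel_nonneg _ _ hs)))
    rw [norm_mul, Real.norm_of_nonneg (invGammaKernel_nonneg _ _ hs),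
      Real.norm_of_nonneg (invGammaKernel_nonneg _ _ hs),
      Real.norm_of_nonneg (by positivity)]
    refine add_le_add (invGammaKernel_anti _ hle hs) (mul_le_mul (by gcongr)
      (invGammaKernel_anti _ hle hs) (invGammaKernel_nonneg _ _ hs) (by positivity))
  · exact ((integrableOn_invGammaKernel (by norm_num) (by positivity)).add
      ((integrableOn_invGammaKernel (by norm_num) (by positivity)).const_mul _)).mul_const M
  · filter_upwards [ae_restrict_mem measurableSet_Ioi] with s hs x _
    exact ((hasDerivAt_mul_invGammaKernel x s hs).ofReal_comp).mul_const (h s)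

/-- The derivative of `subordKernel t`. -/
noncomputable def subordKernelDeriv (t s : ℝ) : ℝ :=
  -(3 / 2 * t) * invGammaKernel (5 / 2) (t ^ 2 / 4) s
    + 3 / 2 * t ^ 3 * invGammaKernel (7 / 2) (t ^ 2 / 4) s
    - t ^ 5 / 8 * invGammaKernel (9 / 2) (t ^ 2 / 4) s

lemma hasDerivAt_subordKernel (t : ℝ) {s : ℝ} (hs : 0 < s) :
    HasDerivAt (subordKernel t) (subordKernelDeriv t s) s := by
  refine (((hasDerivAt_invGammaKernel (3 / 2) (t ^ 2 / 4) hs).const_mul t).sub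
    ((hasDerivAt_invGammaKernel (5 / 2) (t ^ 2 / 4) hs).const_mul (t ^ 3 / 2))).congr_deriv ?_
  norm_num [subordKernelDeriv]
  ring

lemma psi_div_sqrt (t : ℝ) {s : ℝ} (hs : 0 < s) :
    psi (t / Real.sqrt s) = -(2 * Real.sqrt Real.pi)⁻¹ * (subordKernelDeriv t s * s ^ 2) := by
  have hw : 0 < Real.sqrt s := Real.sqrt_pos.2 hs
  have hsq : s = Real.sqrt s ^ 2 := (Real.sq_sqrt hs.le).symm
  have key (n : ℕ) : s ^ (-(n / 2) : ℝ) = (Real.sqrt s ^ n)⁻¹ := by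
    rw [Real.rpow_neg hs.le, Real.sqrt_eq_rpow, ← Real.rpow_natCast, ← Real.rpow_mul hs.le]
    congr 2
    ring
  have k5 := key 5
  have k7 := key 7
  have k9 := key 9
  push_cast at k5 k7 k9
  have hexp : -((t / Real.sqrt s) ^ 2) / 4 = -(t ^ 2 / 4) / s := by
    rw [div_pow, Real.sq_sqrt hs.le]; ring
  have hpi : 0 < Real.sqrt Real.pi := Real.sqrt_pos.2 Real.pi_pos
  have hs2 : s ^ 2 = Real.sqrt s ^ 4 := by
    rw [show (4 : ℕ) = 2 * 2 from rfl, pow_mul, Real.sq_sqrt hs.le]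
  simp only [psi, subordKernelDeriv, invGammaKernel, hexp, k5, k7, k9, hs2]
  generalize Real.exp (-(t ^ 2 / 4) / s) = e
  field_simp
  ring

section Primitive

variable {h : ℝ → ℂ} {M : ℝ}

lemma norm_primitive_le (hM : ∀ s, ‖h s‖ ≤ M) {s : ℝ} (hs : 0 < s) :
    ‖∫ r in (0 : ℝ)..s, h r‖ ≤ M * s := by
  simpa [abs_of_pos hs] using
    intervalIntegral.norm_integral_le_of_norm_le_const (a := 0) (b := s) fun r _ => hM r

lemma norm_subordKernel_mul_primitive_le (hM : ∀ s, ‖h s‖ ≤ M) {t s : ℝ} (ht : 0 < t)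
    (hs : 0 < s) :
    ‖(subordKernel t s : ℂ) * ∫ r in (0 : ℝ)..s, h r‖ ≤
      M * (t * invGammaKernel (1 / 2) (t ^ 2 / 4) s
        + t ^ 3 / 2 * invGammaKernel (3 / 2) (t ^ 2 / 4) s) := by
  have e1 := mul_invGammaKernel (1 / 2) (t ^ 2 / 4) hs
  have e2 := mul_invGammaKernel (3 / 2) (t ^ 2 / 4) hs
  rw [show (1 / 2 : ℝ) + 1 = 3 / 2 by norm_num] at e1
  rw [show (3 / 2 : ℝ) + 1 = 5 / 2 by norm_num] at e2
  have hK : ‖subordKernel t s‖ ≤ t * invGammaKernel (3 / 2) (t ^ 2 / 4) s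
      + t ^ 3 / 2 * invGammaKernel (5 / 2) (t ^ 2 / 4) s := by
    refine (norm_sub_le _ _).trans_eq ?_
    rw [Real.norm_of_nonneg (mul_nonneg ht.le (invGammaKernel_nonneg _ _ hs)),
      Real.norm_of_nonneg (mul_nonneg (by positivity) (invGammaKernel_nonneg _ _ hs))]
  rw [norm_mul, Complex.norm_real]
  refine (mul_le_mul hK (norm_primitive_le hM hs) (norm_nonneg _)
    ((norm_nonneg _).trans hK)).trans_eq ?_
  rw [← e1]
  linear_combination M * t ^ 3 / 2 * e2

lemma integrableOn_subordKernelDeriv_mul_primitive (hcont : Continuous h)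
    (hM : ∀ s, ‖h s‖ ≤ M) {t : ℝ} (ht : 0 < t) :
    IntegrableOn (fun s => (subordKernelDeriv t s : ℂ) * ∫ r in (0 : ℝ)..s, h r)
      (Set.Ioi 0) := by
  have hk : IntegrableOn (fun s => s * subordKernelDeriv t s) (Set.Ioi 0) := by
    have hi (p : ℝ) (hp : 1 < p) (c : ℝ) :=
      (integrableOn_invGammaKernel hp (show 0 < t ^ 2 / 4 by positivity)).const_mul c
    refine IntegrableOn.congr_fun (((hi (3 / 2) (by norm_num) (-(3 / 2 * t))).add
      (hi (5 / 2) (by norm_num) (3 / 2 * t ^ 3))).sub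
      (hi (7 / 2) (by norm_num) (t ^ 5 / 8))) (fun s hs => ?_) measurableSet_Ioi
    have e1 := mul_invGammaKernel (3 / 2) (t ^ 2 / 4) hs
    have e2 := mul_invGammaKernel (5 / 2) (t ^ 2 / 4) hs
    have e3 := mul_invGammaKernel (7 / 2) (t ^ 2 / 4) hs
    norm_num at e1 e2 e3
    simp only [Pi.add_apply, Pi.sub_apply, subordKernelDeriv]
    linear_combination 3 / 2 * t * e1 - 3 / 2 * t ^ 3 * e2 + t ^ 5 / 8 * e3
  have hprim : Continuous fun s => ∫ r in (0 : ℝ)..s, h r :=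
    intervalIntegral.continuous_primitive (fun a b => hcont.intervalIntegrable a b) 0
  have hkm : ContinuousOn (subordKernelDeriv t) (Set.Ioi 0) :=
    (((continuousOn_invGammaKernel _ _).const_mul _).add
      ((continuousOn_invGammaKernel _ _).const_mul _)).sub
      ((continuousOn_invGammaKernel _ _).const_mul _)
  refine (hk.norm.const_mul M).mono' ?_ ?_
  · exact ((Complex.continuous_ofReal.comp_continuousOn hkm).mul
      hprim.continuousOn).aestronglyMeasurable measurableSet_Ioi
  · filter_upwards [ae_restrict_mem measurableSet_Ioi] with s hs
    have hs : 0 < s := hs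
    rw [norm_mul, norm_mul, Complex.norm_real, Real.norm_of_nonneg hs.le]
    calc _ ≤ ‖subordKernelDeriv t s‖ * (M * s) := by gcongr; exact norm_primitive_le hM hs
      _ = _ := by ring

lemma integral_subordKernel_mul (hcont : Continuous h) (hM : ∀ s, ‖h s‖ ≤ M)
    {t : ℝ} (ht : 0 < t) :
    ∫ s in Set.Ioi (0 : ℝ), (subordKernel t s : ℂ) * h s =
      -∫ s in Set.Ioi (0 : ℝ), (subordKernelDeriv t s : ℂ) * ∫ r in (0 : ℝ)..s, h r := by
  have hlim {l : Filter ℝ} (hl : ∀ᶠ s in l, 0 < s)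
      (h1 : Filter.Tendsto (invGammaKernel (1 / 2) (t ^ 2 / 4)) l (nhds 0))
      (h2 : Filter.Tendsto (invGammaKernel (3 / 2) (t ^ 2 / 4)) l (nhds 0)) :
      Filter.Tendsto ((fun s => (subordKernel t s : ℂ)) * fun s => ∫ r in (0 : ℝ)..s, h r) l
        (nhds 0) := by
    have hb := ((h1.const_mul t).add (h2.const_mul (t ^ 3 / 2))).const_mul M
    simp only [mul_zero, add_zero] at hb
    refine squeeze_zero_norm' ?_ hb
    filter_upwards [hl] with s hs using norm_subordKernel_mul_primitive_le hM ht hs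
  rw [integral_Ioi_mul_deriv_eq_deriv_mul (a' := 0) (b' := 0)
    (u' := fun s => (subordKernelDeriv t s : ℂ)) (v := fun s => ∫ r in (0 : ℝ)..s, h r)
    (fun s hs => (hasDerivAt_subordKernel t hs).ofReal_comp)
    (fun s _ => hcont.integral_hasStrictDerivAt 0 s |>.hasDerivAt)
    (integrableOn_ofReal_mul_of_bdd (integrableOn_subordKernel ht) hcont hM)
    (integrableOn_subordKernelDeriv_mul_primitive hcont hM ht)
    (hlim self_mem_nhdsWithin (tendsto_invGammaKernel_zero _ (by positivity))
      (tendsto_invGammaKernel_zero _ (by positivity)))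
    (hlim (Filter.eventually_gt_atTop 0) (tendsto_invGammaKernel_atTop _ (by norm_num))
      (tendsto_invGammaKernel_atTop _ (by norm_num)))]
  simp

end Primitive

lemma integral_psi_mul_ergAvg_comp_mul (h : ℝ → ℂ) {t : ℝ} (ht : 0 < t) :
    ∫ s in Set.Ioi (0 : ℝ), ((psi (1 / Real.sqrt s) : ℂ) * ergAvg h (t ^ 2 * s)) / (s : ℂ) =
      ∫ s in Set.Ioi (0 : ℝ), ((psi (t / Real.sqrt s) : ℂ) * ergAvg h s) / (s : ℂ) := by
  have ht2 : 0 < t ^ 2 := by positivity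
  have hc := integral_comp_mul_left_Ioi
    (fun s => ((psi (t / Real.sqrt s) : ℂ) * ergAvg h s) / (s : ℂ)) 0 ht2
  rw [mul_zero, eq_inv_smul_iff₀ ht2.ne', ← integral_smul] at hc
  rw [← hc]
  refine setIntegral_congr_fun measurableSet_Ioi fun s hs => ?_
  have hs : 0 < s := hs
  have hsC : (s : ℂ) ≠ 0 := by exact_mod_cast hs.ne'
  have htC : (t : ℂ) ≠ 0 := by exact_mod_cast ht.ne'
  have e : t / Real.sqrt (t ^ 2 * s) = 1 / Real.sqrt s := by
    rw [Real.sqrt_mul ht2.le, Real.sqrt_sq ht.le]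
    field_simp
  simp only [e, Complex.real_smul]
  push_cast
  field_simp

/-- For bounded continuous `h`, `Q` is differentiable on `(0,∞)` and
`t·Q'(t) = (1/(2√π)) ∫_0^∞ (t·s^{−3/2} − (t³/2)·s^{−5/2}) e^{−t²/(4s)} h(s) ds
         = ∫_0^∞ ψ(t/√s)·m(s) ds/s = ∫_0^∞ ψ(1/√s)·m(t²s) ds/s`. -/
theorem deriv_subordQ (h : ℝ → ℂ) (hcont : Continuous h)
    (hbdd : ∃ M : ℝ, ∀ s : ℝ, ‖h s‖ ≤ M) :
    ∀ t : ℝ, 0 < t →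
      DifferentiableAt ℝ (subordQ h) t ∧
        (t : ℂ) * deriv (subordQ h) t
          = ((2 * Real.sqrt Real.pi)⁻¹ : ℂ) *
              ∫ s in Set.Ioi (0 : ℝ),
                (((t * s ^ (-(3 : ℝ) / 2) - t ^ 3 / 2 * s ^ (-(5 : ℝ) / 2)) *
                  Real.exp (-t ^ 2 / (4 * s)) : ℝ) : ℂ) * h s ∧
        (t : ℂ) * deriv (subordQ h) t
          = ∫ s in Set.Ioi (0 : ℝ), ((psi (t / Real.sqrt s) : ℂ) * ergAvg h s) / (s : ℂ) ∧
        (t : ℂ) * deriv (subordQ h) t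
          = ∫ s in Set.Ioi (0 : ℝ), ((psi (1 / Real.sqrt s) : ℂ) * ergAvg h (t ^ 2 * s)) / (s : ℂ) := by
  obtain ⟨M, hM⟩ := hbdd
  intro t ht
  have hQ := hasDerivAt_subordQ hcont hM ht
  have hkernel : (t : ℂ) * deriv (subordQ h) t = ((2 * Real.sqrt Real.pi)⁻¹ : ℂ) *
      ∫ s in Set.Ioi (0 : ℝ), (subordKernel t s : ℂ) * h s := by
    rw [hQ.deriv, mul_left_comm, ← integral_const_mul]
    congr 2 with s
    simp only [subordKernel]
    push_cast
    ring
  have hpsi : (t : ℂ) * deriv (subordQ h) t =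
      ∫ s in Set.Ioi (0 : ℝ), ((psi (t / Real.sqrt s) : ℂ) * ergAvg h s) / (s : ℂ) := by
    rw [hkernel, integral_subordKernel_mul hcont hM ht, mul_neg, ← neg_mul,
      ← integral_const_mul]
    refine setIntegral_congr_fun measurableSet_Ioi fun s hs => ?_
    have hs : 0 < s := hs
    have hsC : (s : ℂ) ≠ 0 := by exact_mod_cast hs.ne'
    simp only [psi_div_sqrt t hs, ergAvg]
    push_cast
    field_simp
  refine ⟨hQ.differentiableAt, ?_, hpsi, hpsi.trans (integral_psi_mul_ergAvg_comp_mul h ht).symm⟩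
  simp only [hkernel, subordKernel_eq]
end
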